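/- Let r > 0, let q = e^{−π√r}, and let k ∈ (0,1) satisfy K(√(1−k²)) = √r · K(k). Then k = 4 q^{1/2} · exp(−4 ∑_{n=1}^∞ q^n ∑_{d | n} (−1)^{d + n/d} / d), where the inner sum runs over the positive divisors d of n. -/

import Mathlib

open Real

/-- Complete elliptic integral of the first kind. -/
noncomputable def ellK (x : ℝ) : ℝ :=
  ∫ θ in (0:ℝ)..(π/2), (1 - x ^ 2 * Real.sin θ ^ 2) ^ (-(1:ℝ)/2)

/-- The eta product `η(q) = ∏_{n≥1} (1 - q^n)` (real powers). -/
noncomputable def etaP (q : ℝ) : ℝ := ∏' n : ℕ, (1 - q ^ ((n : ℝ) + 1))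

/-- `A(a,p;q) = q^{p/12 - a/2 + a²/(2p)} ∏_{n≥1} (1 - q^{np+a})(1 - q^{np+p-a})`. -/
noncomputable def Afun (a p q : ℝ) : ℝ :=
  q ^ (p / 12 - a / 2 + a ^ 2 / (2 * p)) *
    ∏' n : ℕ, ((1 - q ^ (((n : ℝ) + 1) * p + a)) * (1 - q ^ (((n : ℝ) + 1) * p + p - a)))

open Filter Topology

/-! ### Theta null values -/

/-- The theta null value `θ₃(q) = ∑ q^(n²)`. -/
noncomputable def thetaThree (q : ℝ) : ℝ := ∑' n : ℤ, q ^ (n ^ 2)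

/-- The theta null value `θ₄(q) = ∑ (-1)^n q^(n²)`. -/
noncomputable def thetaFour (q : ℝ) : ℝ := ∑' n : ℤ, (-1 : ℝ) ^ n * q ^ (n ^ 2)

/-- The normalised theta null value `q^(-1/4) θ₂(q) = ∑ q^(n² + n)`. -/
noncomputable def thetaTwo (q : ℝ) : ℝ := ∑' n : ℤ, q ^ (n ^ 2 + n)

lemma summable_zpow_natAbs {q : ℝ} (h0 : 0 < q) (h1 : q < 1) :
    Summable fun n : ℤ => q ^ n.natAbs := by
  rw [summable_int_iff_summable_nat_and_neg]
  simpa using summable_geometric_of_lt_one h0.le h1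

lemma summable_zpow_of_natAbs_le {q : ℝ} (h0 : 0 < q) (h1 : q < 1) {e : ℤ → ℤ}
    (he : ∀ n, |n| - 1 ≤ e n) : Summable fun n : ℤ => q ^ e n := by
  refine Summable.of_nonneg_of_le (fun n => (zpow_pos h0 _).le) (fun n => ?_)
    ((summable_zpow_natAbs h0 h1).mul_left q⁻¹)
  calc q ^ e n ≤ q ^ (|n| - 1) := zpow_le_zpow_right_of_le_one₀ h0 h1.le (he n)
    _ = q⁻¹ * q ^ n.natAbs := by
      rw [zpow_sub_one₀ h0.ne', Int.abs_eq_natAbs, zpow_natCast, mul_comm]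

lemma abs_sub_one_le_sq (n : ℤ) : |n| - 1 ≤ n ^ 2 := by
  rcases abs_cases n with h | h <;> nlinarith [sq_nonneg n]

lemma abs_sub_one_le_sq_add (n : ℤ) : |n| - 1 ≤ n ^ 2 + n := by
  rcases abs_cases n with h | h <;> nlinarith [sq_nonneg (n + 1)]

lemma summable_thetaThree {q : ℝ} (h0 : 0 < q) (h1 : q < 1) :
    Summable fun n : ℤ => q ^ (n ^ 2) :=
  summable_zpow_of_natAbs_le h0 h1 abs_sub_one_le_sq

lemma summable_thetaTwo {q : ℝ} (h0 : 0 < q) (h1 : q < 1) :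
    Summable fun n : ℤ => q ^ (n ^ 2 + n) :=
  summable_zpow_of_natAbs_le h0 h1 abs_sub_one_le_sq_add

lemma Summable.neg_one_zpow_mul {f : ℤ → ℝ} (hf : Summable f) :
    Summable fun n : ℤ => (-1 : ℝ) ^ n * f n := by
  refine Summable.of_norm ?_
  simpa [norm_mul, norm_zpow] using hf.norm

lemma summable_thetaFour {q : ℝ} (h0 : 0 < q) (h1 : q < 1) :
    Summable fun n : ℤ => (-1 : ℝ) ^ n * q ^ (n ^ 2) :=
  (summable_thetaThree h0 h1).neg_one_zpow_mul

lemma thetaThree_pos {q : ℝ} (h0 : 0 < q) (h1 : q < 1) : 0 < thetaThree q :=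
  (summable_thetaThree h0 h1).tsum_pos (fun _ => (zpow_pos h0 _).le) 0 (zpow_pos h0 _)

lemma thetaTwo_pos {q : ℝ} (h0 : 0 < q) (h1 : q < 1) : 0 < thetaTwo q :=
  (summable_thetaTwo h0 h1).tsum_pos (fun _ => (zpow_pos h0 _).le) 0 (zpow_pos h0 _)

/-- `ℤ × ℤ` splits into the pairs of equal parity `(a + b, a - b)` and the pairs of different
parity `(a + b + 1, a - b)`. -/
def intPairParityEquiv : (ℤ × ℤ) ⊕ (ℤ × ℤ) ≃ ℤ × ℤ where
  toFun := Sum.elim (fun p => (p.1 + p.2, p.1 - p.2)) (fun p => (p.1 + p.2 + 1, p.1 - p.2))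
  invFun p := if (p.1 - p.2) % 2 = 0 then .inl ((p.1 + p.2) / 2, (p.1 - p.2) / 2)
    else .inr ((p.1 + p.2 - 1) / 2, (p.1 - p.2 - 1) / 2)
  left_inv := by
    rintro (⟨a, b⟩ | ⟨a, b⟩)
    · have h : (a + b - (a - b)) % 2 = 0 := by omega
      simp only [Sum.elim_inl, h, if_true, Sum.inl.injEq, Prod.mk.injEq]
      omega
    · have h : ¬ (a + b + 1 - (a - b)) % 2 = 0 := by omega
      simp only [Sum.elim_inr, h, if_false, Sum.inr.injEq, Prod.mk.injEq]
      omega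
  right_inv := by
    rintro ⟨m, n⟩
    by_cases h : (m - n) % 2 = 0
    · simp only [h, if_true, Sum.elim_inl, Prod.mk.injEq]
      omega
    · simp only [h, if_false, Sum.elim_inr, Prod.mk.injEq]
      omega

lemma tsum_mul_tsum_parity {f g u v u' v' : ℤ → ℝ} (hf : Summable f) (hg : Summable g)
    (hu : Summable u) (hv : Summable v) (hu' : Summable u') (hv' : Summable v')
    (h : ∀ a b, f (a + b) * g (a - b) = u a * v b)
    (h' : ∀ a b, f (a + b + 1) * g (a - b) = u' a * v' b) :
    (∑' n, f n) * ∑' n, g n = (∑' n, u n) * (∑' n, v n) + (∑' n, u' n) * ∑' n, v' n := by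
  rw [tsum_mul_tsum_of_summable_norm hf.norm hg.norm,
    tsum_mul_tsum_of_summable_norm hu.norm hv.norm,
    tsum_mul_tsum_of_summable_norm hu'.norm hv'.norm, ← intPairParityEquiv.tsum_eq,
    Summable.tsum_sum]
  · congr 1
    · exact tsum_congr fun p => h p.1 p.2
    · exact tsum_congr fun p => h' p.1 p.2
  · exact (summable_mul_of_summable_norm hu.norm hv.norm).congr fun p => (h p.1 p.2).symm
  · exact (summable_mul_of_summable_norm hu'.norm hv'.norm).congr fun p => (h' p.1 p.2).symm

lemma neg_one_zpow_add_mul_sub (a b : ℤ) : (-1 : ℝ) ^ (a + b) * (-1 : ℝ) ^ (a - b) = 1 := by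
  rw [← zpow_add₀ (by norm_num), show a + b + (a - b) = 2 * a by ring, zpow_mul]
  norm_num

lemma tsum_neg_one_zpow_mul_zpow_sq_add (q : ℝ) :
    ∑' n : ℤ, (-1 : ℝ) ^ n * q ^ (n ^ 2 + n) = 0 := by
  have h : ∀ n : ℤ, (-1 : ℝ) ^ (-1 - n) * q ^ ((-1 - n) ^ 2 + (-1 - n)) =
      -((-1 : ℝ) ^ n * q ^ (n ^ 2 + n)) := fun n => by
    rw [show (-1 - n) ^ 2 + (-1 - n) = n ^ 2 + n by ring, zpow_sub₀ (by norm_num)]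
    rcases Int.even_or_odd n with hn | hn <;> simp [hn.neg_one_zpow]
  have := (Equiv.subLeft (-1 : ℤ)).tsum_eq fun n : ℤ => (-1 : ℝ) ^ n * q ^ (n ^ 2 + n)
  simp only [Equiv.subLeft_apply, h, tsum_neg] at this
  linarith

section Duplication

variable {q : ℝ} (h0 : 0 < q) (h1 : q < 1)
include h0 h1

lemma thetaThree_sq :
    thetaThree q ^ 2 = thetaThree (q ^ 2) ^ 2 + q * thetaTwo (q ^ 2) ^ 2 := by
  have h0' : 0 < q ^ 2 := by positivity
  have h1' : q ^ 2 < 1 := by nlinarith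
  have s3 := summable_thetaThree h0 h1
  have s3' := summable_thetaThree h0' h1'
  have s2' := summable_thetaTwo h0' h1'
  have := tsum_mul_tsum_parity s3 s3 s3' s3' (s2'.mul_left q) s2'
    (fun a b => by
      rw [← zpow_natCast q 2, ← zpow_mul, ← zpow_mul, ← zpow_add₀ h0.ne', ← zpow_add₀ h0.ne']
      congr 1; push_cast; ring)
    (fun a b => by
      nth_rewrite 3 [← zpow_one q]
      rw [← zpow_natCast q 2, ← zpow_mul, ← zpow_mul, ← zpow_add₀ h0.ne', ← zpow_add₀ h0.ne',
        ← zpow_add₀ h0.ne']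
      congr 1; push_cast; ring)
  rw [tsum_mul_left] at this
  simp only [thetaThree, thetaTwo]
  linear_combination this

lemma thetaFour_sq :
    thetaFour q ^ 2 = thetaThree (q ^ 2) ^ 2 - q * thetaTwo (q ^ 2) ^ 2 := by
  have h0' : 0 < q ^ 2 := by positivity
  have h1' : q ^ 2 < 1 := by nlinarith
  have s4 := summable_thetaFour h0 h1
  have s3' := summable_thetaThree h0' h1'
  have s2' := summable_thetaTwo h0' h1'
  have := tsum_mul_tsum_parity s4 s4 s3' s3' (s2'.mul_left (-q)) s2'
    (fun a b => by
      rw [mul_mul_mul_comm, neg_one_zpow_add_mul_sub, one_mul, ← zpow_natCast q 2, ← zpow_mul,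
        ← zpow_mul, ← zpow_add₀ h0.ne', ← zpow_add₀ h0.ne']
      congr 1; push_cast; ring)
    (fun a b => by
      rw [mul_mul_mul_comm, zpow_add_one₀ (by norm_num), mul_right_comm ((-1 : ℝ) ^ (a + b)),
        neg_one_zpow_add_mul_sub, one_mul, neg_one_mul, neg_mul, neg_mul, neg_inj]
      nth_rewrite 3 [← zpow_one q]
      rw [← zpow_natCast q 2, ← zpow_mul, ← zpow_mul, ← zpow_add₀ h0.ne', ← zpow_add₀ h0.ne',
        ← zpow_add₀ h0.ne']
      congr 1; push_cast; ring)
  rw [tsum_mul_left] at this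
  simp only [thetaThree, thetaTwo, thetaFour]
  linear_combination this

lemma thetaThree_mul_thetaFour : thetaThree q * thetaFour q = thetaFour (q ^ 2) ^ 2 := by
  have h0' : 0 < q ^ 2 := by positivity
  have h1' : q ^ 2 < 1 := by nlinarith
  have s3 := summable_thetaThree h0 h1
  have s4 := summable_thetaFour h0 h1
  have s4' := summable_thetaFour h0' h1'
  have s2' := (summable_thetaTwo h0' h1').neg_one_zpow_mul
  have hs : ∀ a b : ℤ, (-1 : ℝ) ^ (a - b) = (-1) ^ a * (-1) ^ b := fun a b => by
    rw [zpow_sub₀ (by norm_num), div_eq_mul_inv, ← inv_zpow]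
    norm_num
  have := tsum_mul_tsum_parity s3 s4 s4' s4' (s2'.mul_left q) s2'
    (fun a b => by
      rw [mul_left_comm, mul_mul_mul_comm, hs, ← zpow_natCast q 2, ← zpow_mul,
        ← zpow_mul, ← zpow_add₀ h0.ne', ← zpow_add₀ h0.ne']
      congr 2; push_cast; ring)
    (fun a b => by
      rw [mul_left_comm, mul_assoc q, mul_mul_mul_comm, hs, mul_left_comm q]
      nth_rewrite 3 [← zpow_one q]
      rw [← zpow_natCast q 2, ← zpow_mul, ← zpow_mul, ← zpow_add₀ h0.ne', ← zpow_add₀ h0.ne',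
        ← zpow_add₀ h0.ne']
      congr 2; push_cast; ring)
  rw [tsum_mul_left, tsum_neg_one_zpow_mul_zpow_sq_add] at this
  simp only [thetaThree, thetaFour]
  linear_combination this

lemma thetaTwo_sq : thetaTwo q ^ 2 = 2 * thetaTwo (q ^ 2) * thetaThree (q ^ 2) := by
  have h0' : 0 < q ^ 2 := by positivity
  have h1' : q ^ 2 < 1 := by nlinarith
  have s2 := summable_thetaTwo h0 h1
  have s3' := summable_thetaThree h0' h1'
  have s2' := summable_thetaTwo h0' h1'
  have s3s : Summable fun n : ℤ => (q ^ 2) ^ ((n + 1) ^ 2) :=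
    s3'.comp_injective (add_left_injective (1 : ℤ))
  have e3s : ∑' n : ℤ, (q ^ 2) ^ ((n + 1) ^ 2) = ∑' n : ℤ, (q ^ 2) ^ (n ^ 2) :=
    (Equiv.addRight (1 : ℤ)).tsum_eq fun n : ℤ => (q ^ 2) ^ (n ^ 2)
  have := tsum_mul_tsum_parity s2 s2 s2' s3' s3s s2'
    (fun a b => by
      rw [← zpow_natCast q 2, ← zpow_mul, ← zpow_mul, ← zpow_add₀ h0.ne', ← zpow_add₀ h0.ne']
      congr 1; push_cast; ring)
    (fun a b => by
      rw [← zpow_natCast q 2, ← zpow_mul, ← zpow_mul, ← zpow_add₀ h0.ne', ← zpow_add₀ h0.ne']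
      congr 1; push_cast; ring)
  rw [e3s] at this
  simp only [thetaThree, thetaTwo]
  linear_combination this

/-- Jacobi's quartic identity. -/
lemma thetaThree_pow_four_sub :
    thetaThree q ^ 4 - thetaFour q ^ 4 = q * thetaTwo q ^ 4 := by
  have e3 := thetaThree_sq h0 h1
  have e4 := thetaFour_sq h0 h1
  have e2 := thetaTwo_sq h0 h1
  rw [show thetaThree q ^ 4 = (thetaThree q ^ 2) ^ 2 by ring,
    show thetaFour q ^ 4 = (thetaFour q ^ 2) ^ 2 by ring,
    show thetaTwo q ^ 4 = (thetaTwo q ^ 2) ^ 2 by ring, e2, e3, e4]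
  ring

end Duplication

/-! ### Gauss's elliptic integral and the arithmetic-geometric mean -/

/-- Gauss's form `∫₀^{π/2} dθ / √(a² cos² θ + b² sin² θ)` of the complete elliptic integral. -/
noncomputable def gaussIntegral (a b : ℝ) : ℝ :=
  ∫ θ in (0 : ℝ)..(π / 2), (√(a ^ 2 * cos θ ^ 2 + b ^ 2 * sin θ ^ 2))⁻¹

lemma sq_mul_cos_sq_add_pos {a b : ℝ} (ha : 0 < a) (hb : 0 < b) (x : ℝ) :
    0 < a ^ 2 * cos x ^ 2 + b ^ 2 * sin x ^ 2 := by
  rcases eq_or_ne (cos x) 0 with h | h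
  · have : sin x ^ 2 = 1 := by nlinarith [sin_sq_add_cos_sq x]
    rw [h, this]; positivity
  · positivity

lemma mul_cos_sq_add_pos {a b : ℝ} (ha : 0 < a) (hb : 0 < b) (x : ℝ) :
    0 < a * cos x ^ 2 + b * sin x ^ 2 := by
  rcases eq_or_ne (cos x) 0 with h | h
  · have : sin x ^ 2 = 1 := by nlinarith [sin_sq_add_cos_sq x]
    rw [h, this]; linarith
  · positivity

lemma continuous_gaussIntegrand {a b : ℝ} (ha : 0 < a) (hb : 0 < b) :
    Continuous fun θ => (√(a ^ 2 * cos θ ^ 2 + b ^ 2 * sin θ ^ 2))⁻¹ :=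
  Continuous.inv₀ (by fun_prop) fun x => (sqrt_pos.2 (sq_mul_cos_sq_add_pos ha hb x)).ne'

/-- The amplitude of Landen's transformation. -/
noncomputable def landenAmplitude (a b x : ℝ) : ℝ :=
  2 * x - arctan ((a - b) * (sin x * cos x) / (a * cos x ^ 2 + b * sin x ^ 2))

section Landen

variable {a b : ℝ} (ha : 0 < a) (hb : 0 < b)
include ha hb

lemma one_add_landen_sq (x : ℝ) :
    1 + ((a - b) * (sin x * cos x) / (a * cos x ^ 2 + b * sin x ^ 2)) ^ 2 =
      (a ^ 2 * cos x ^ 2 + b ^ 2 * sin x ^ 2) / (a * cos x ^ 2 + b * sin x ^ 2) ^ 2 := by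
  have hD := (mul_cos_sq_add_pos ha hb x).ne'
  field_simp
  rw [cos_sq']
  ring

lemma hasDerivAt_landenAmplitude (x : ℝ) :
    HasDerivAt (landenAmplitude a b) ((a + b) * (a * cos x ^ 2 + b * sin x ^ 2) /
      (a ^ 2 * cos x ^ 2 + b ^ 2 * sin x ^ 2)) x := by
  have hD := (mul_cos_sq_add_pos ha hb x).ne'
  have hN := (sq_mul_cos_sq_add_pos ha hb x).ne'
  have hs := hasDerivAt_sin x
  have hc := hasDerivAt_cos x
  have h := ((hasDerivAt_id x).const_mul 2).sub
    ((((hs.mul hc).const_mul (a - b)).div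
      (((hc.pow 2).const_mul a).add ((hs.pow 2).const_mul b)) hD).arctan)
  refine h.congr_deriv ?_
  simp only [Pi.add_apply, Pi.mul_apply, Pi.pow_apply, Pi.div_apply]
  rw [one_add_landen_sq ha hb x]
  field_simp
  simp only [Nat.cast_ofNat, Nat.add_one_sub_one, pow_one]
  linear_combination (-(2 * (a ^ 2 * cos x ^ 2 + b ^ 2 * sin x ^ 2) -
    (a * cos x ^ 2 + b * sin x ^ 2) * (a + b))) * sin_sq_add_cos_sq x

lemma cos_arctan_landen (x : ℝ) :
    cos (arctan ((a - b) * (sin x * cos x) / (a * cos x ^ 2 + b * sin x ^ 2))) =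
      (a * cos x ^ 2 + b * sin x ^ 2) / √(a ^ 2 * cos x ^ 2 + b ^ 2 * sin x ^ 2) := by
  rw [cos_arctan, one_add_landen_sq ha hb, sqrt_div' _ (sq_nonneg _),
    sqrt_sq (mul_cos_sq_add_pos ha hb x).le, one_div_div]

lemma sin_arctan_landen (x : ℝ) :
    sin (arctan ((a - b) * (sin x * cos x) / (a * cos x ^ 2 + b * sin x ^ 2))) =
      (a - b) * (sin x * cos x) / √(a ^ 2 * cos x ^ 2 + b ^ 2 * sin x ^ 2) := by
  rw [sin_arctan, one_add_landen_sq ha hb, sqrt_div' _ (sq_nonneg _),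
    sqrt_sq (mul_cos_sq_add_pos ha hb x).le,
    div_div_div_cancel_right₀ (mul_cos_sq_add_pos ha hb x).ne']

lemma cos_landenAmplitude (x : ℝ) :
    cos (landenAmplitude a b x) = (a * cos x ^ 2 - b * sin x ^ 2) /
      √(a ^ 2 * cos x ^ 2 + b ^ 2 * sin x ^ 2) := by
  rw [landenAmplitude, cos_sub, cos_arctan_landen ha hb, sin_arctan_landen ha hb, cos_two_mul,
    sin_two_mul, ← mul_div_assoc, ← mul_div_assoc, ← add_div]
  congr 1
  linear_combination (2 * a * cos x ^ 2) * sin_sq_add_cos_sq x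

lemma sin_landenAmplitude (x : ℝ) :
    sin (landenAmplitude a b x) = (a + b) * (sin x * cos x) /
      √(a ^ 2 * cos x ^ 2 + b ^ 2 * sin x ^ 2) := by
  rw [landenAmplitude, sin_sub, cos_arctan_landen ha hb, sin_arctan_landen ha hb, cos_two_mul,
    sin_two_mul, ← mul_div_assoc, ← mul_div_assoc, ← sub_div]
  congr 1
  linear_combination (2 * b * sin x * cos x) * sin_sq_add_cos_sq x

lemma sqrt_landenAmplitude (x : ℝ) :
    √(((a + b) / 2) ^ 2 * cos (landenAmplitude a b x) ^ 2 +
      √(a * b) ^ 2 * sin (landenAmplitude a b x) ^ 2) =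
      (a + b) * (a * cos x ^ 2 + b * sin x ^ 2) /
        (2 * √(a ^ 2 * cos x ^ 2 + b ^ 2 * sin x ^ 2)) := by
  have hD := mul_cos_sq_add_pos ha hb x
  have hN := sq_mul_cos_sq_add_pos ha hb x
  have hN' := sqrt_pos.2 hN
  rw [sqrt_eq_iff_mul_self_eq (by positivity) (by positivity), cos_landenAmplitude ha hb,
    sin_landenAmplitude ha hb, sq_sqrt (by positivity)]
  field_simp
  ring

/-- Gauss's invariance of the elliptic integral under the arithmetic-geometric mean step. -/
lemma gaussIntegral_agm : gaussIntegral ((a + b) / 2) (√(a * b)) = gaussIntegral a b := by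
  have ha1 : 0 < (a + b) / 2 := by positivity
  have hb1 : 0 < √(a * b) := by positivity
  have hcont := continuous_gaussIntegrand ha1 hb1
  set g : ℝ → ℝ :=
    fun θ => (√(((a + b) / 2) ^ 2 * cos θ ^ 2 + √(a * b) ^ 2 * sin θ ^ 2))⁻¹ with hg
  have key := intervalIntegral.integral_comp_mul_deriv (a := 0) (b := π / 2) (g := g)
    (fun x _ => hasDerivAt_landenAmplitude ha hb x)
    (Continuous.continuousOn (Continuous.div (by fun_prop) (by fun_prop)
      fun x => (sq_mul_cos_sq_add_pos ha hb x).ne')) hcont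
  have h0 : landenAmplitude a b 0 = 0 := by simp [landenAmplitude]
  have h1 : landenAmplitude a b (π / 2) = π := by simp [landenAmplitude]; ring
  have hl : ∀ x, (g ∘ landenAmplitude a b) x * ((a + b) * (a * cos x ^ 2 + b * sin x ^ 2) /
      (a ^ 2 * cos x ^ 2 + b ^ 2 * sin x ^ 2)) =
      2 * (√(a ^ 2 * cos x ^ 2 + b ^ 2 * sin x ^ 2))⁻¹ := fun x => by
    have hD := mul_cos_sq_add_pos ha hb x
    have hN := sq_mul_cos_sq_add_pos ha hb x
    have hN' := sqrt_pos.2 hN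
    simp only [hg, Function.comp_apply, sqrt_landenAmplitude ha hb]
    nth_rewrite 2 [← sq_sqrt hN.le]
    field_simp
  have hsym : ∫ x in (π / 2)..π, g x = ∫ x in (0 : ℝ)..(π / 2), g x := by
    have := intervalIntegral.integral_comp_sub_left (a := 0) (b := π / 2) g π
    rw [show π - π / 2 = π / 2 by ring, sub_zero] at this
    rw [← this]
    exact intervalIntegral.integral_congr fun x _ => by simp [hg]
  rw [h0, h1, intervalIntegral.integral_congr fun x _ => hl x,
    intervalIntegral.integral_const_mul, ← intervalIntegral.integral_add_adjacent_intervals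
      (hcont.intervalIntegrable 0 (π / 2)) (hcont.intervalIntegrable (π / 2) π), hsym] at key
  change ∫ x in (0 : ℝ)..(π / 2), g x = ∫ x in (0 : ℝ)..(π / 2), _
  linarith

end Landen

lemma gaussIntegral_le {a b m : ℝ} (hm : 0 < m) (ha : m ≤ a) (hb : m ≤ b) :
    gaussIntegral a b ≤ π / 2 * m⁻¹ := by
  have h := intervalIntegral.integral_mono_on (μ := MeasureTheory.volume) (by positivity :
    (0 : ℝ) ≤ π / 2)
    ((continuous_gaussIntegrand (hm.trans_le ha) (hm.trans_le hb)).intervalIntegrable 0 (π / 2))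
    (intervalIntegrable_const (c := m⁻¹)) fun x _ => by
      gcongr
      refine le_sqrt_of_sq_le ?_
      calc m ^ 2 = m ^ 2 * cos x ^ 2 + m ^ 2 * sin x ^ 2 := by rw [cos_sq']; ring
        _ ≤ _ := by gcongr
  simpa [gaussIntegral] using h

lemma le_gaussIntegral {a b M : ℝ} (ha0 : 0 < a) (hb0 : 0 < b) (ha : a ≤ M) (hb : b ≤ M) :
    π / 2 * M⁻¹ ≤ gaussIntegral a b := by
  have hM : 0 ≤ M := ha0.le.trans ha
  have h := intervalIntegral.integral_mono_on (μ := MeasureTheory.volume) (by positivity :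
    (0 : ℝ) ≤ π / 2) (intervalIntegrable_const (c := M⁻¹))
    ((continuous_gaussIntegrand ha0 hb0).intervalIntegrable 0 (π / 2)) fun x _ => by
      have := sqrt_pos.2 (sq_mul_cos_sq_add_pos ha0 hb0 x)
      gcongr
      refine sqrt_le_iff.2 ⟨hM, ?_⟩
      calc _ ≤ M ^ 2 * cos x ^ 2 + M ^ 2 * sin x ^ 2 := by gcongr
        _ = M ^ 2 := by rw [cos_sq']; ring
  simpa [gaussIntegral] using h

lemma tendsto_gaussIntegral {ι : Type*} {l : Filter ι} {a b : ι → ℝ} (ha : Tendsto a l (𝓝 1))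
    (hb : Tendsto b l (𝓝 1)) :
    Tendsto (fun n => gaussIntegral (a n) (b n)) l (𝓝 (π / 2)) := by
  have ha' := ha.eventually_const_lt (show (0 : ℝ) < 1 by norm_num)
  have hb' := hb.eventually_const_lt (show (0 : ℝ) < 1 by norm_num)
  have hmax := ((ha.max hb).inv₀ (by simp)).const_mul (π / 2)
  have hmin := ((ha.min hb).inv₀ (by simp)).const_mul (π / 2)
  simp only [max_self, min_self, inv_one, mul_one] at hmax hmin
  refine tendsto_of_tendsto_of_tendsto_of_le_of_le' hmax hmin ?_ ?_
  · filter_upwards [ha', hb'] with n h1 h2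
    exact le_gaussIntegral h1 h2 (le_max_left _ _) (le_max_right _ _)
  · filter_upwards [ha', hb'] with n h1 h2
    exact gaussIntegral_le (lt_min h1 h2) (min_le_left _ _) (min_le_right _ _)

/-! ### The elliptic integral at the modulus given by theta functions -/

/-- The nome `e^{-πt}` attached to the point `it` of the upper half plane. -/
noncomputable def nome (t : ℝ) : ℝ := exp (-π * t)

lemma nome_pos (t : ℝ) : 0 < nome t := exp_pos _

lemma nome_lt_one {t : ℝ} (ht : 0 < t) : nome t < 1 := by
  rw [nome, exp_lt_one_iff]
  nlinarith [pi_pos]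

lemma nome_sq (t : ℝ) : nome t ^ 2 = nome (2 * t) := by
  rw [nome, nome, ← exp_nat_mul]
  congr 1; push_cast; ring

lemma exists_eq_nome {q : ℝ} (h0 : 0 < q) (h1 : q < 1) : ∃ t, 0 < t ∧ q = nome t := by
  refine ⟨-log q / π, div_pos (neg_pos.2 (log_neg h0 h1)) pi_pos, ?_⟩
  rw [nome, neg_mul, mul_div_cancel₀ _ pi_ne_zero, neg_neg, exp_log h0]

lemma thetaThree_nome_inv_sq {t : ℝ} (ht : 0 < t) :
    thetaThree (nome t⁻¹) ^ 2 = t * thetaThree (nome t) ^ 2 := by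
  have h : ∀ s : ℝ, thetaThree (nome s) = ∑' n : ℤ, exp (-π * s * (n : ℝ) ^ 2) := fun s =>
    tsum_congr fun n => by
      rw [nome, ← rpow_intCast, ← exp_mul, Int.cast_pow]
  have key := Real.tsum_exp_neg_mul_int_sq ht
  rw [div_eq_mul_inv (-π) t, ← h, ← h, ← sqrt_eq_rpow] at key
  have hs := sqrt_pos.2 ht
  rw [key, mul_pow, div_pow, sq_sqrt ht.le]
  field_simp

lemma nome_mul_thetaTwo_nome_inv_sq {t : ℝ} (ht : 0 < t) :
    nome (t⁻¹ / 2) * thetaTwo (nome t⁻¹) ^ 2 = t * thetaFour (nome t) ^ 2 := by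
  have e1 := thetaThree_sq (nome_pos (t⁻¹ / 2)) (nome_lt_one (by positivity))
  have e3 := thetaThree_sq (nome_pos t) (nome_lt_one ht)
  have e4 := thetaFour_sq (nome_pos t) (nome_lt_one ht)
  rw [nome_sq] at e1 e3 e4
  rw [mul_div_cancel₀ _ (two_ne_zero' ℝ)] at e1
  have i1 := thetaThree_nome_inv_sq ht
  have i2 := thetaThree_nome_inv_sq (mul_pos two_pos ht)
  rw [show (2 * t)⁻¹ = t⁻¹ / 2 by rw [mul_inv]; ring] at i2
  linear_combination i2 - e1 - i1 - t * e3 - t * e4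

lemma thetaFour_ne_zero {q : ℝ} (h0 : 0 < q) (h1 : q < 1) : thetaFour q ≠ 0 := by
  obtain ⟨t, ht, rfl⟩ := exists_eq_nome h0 h1
  have h := nome_mul_thetaTwo_nome_inv_sq ht
  have h2 := thetaTwo_pos (nome_pos t⁻¹) (nome_lt_one (inv_pos.2 ht))
  have h3 := nome_pos (t⁻¹ / 2)
  intro h4
  have : 0 < nome (t⁻¹ / 2) * thetaTwo (nome t⁻¹) ^ 2 := by positivity
  rw [h, h4] at this
  simp at this

lemma gaussIntegral_theta_sq {q : ℝ} (h0 : 0 < q) (h1 : q < 1) :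
    gaussIntegral (thetaThree (q ^ 2) ^ 2) (thetaFour (q ^ 2) ^ 2) =
      gaussIntegral (thetaThree q ^ 2) (thetaFour q ^ 2) := by
  have h3 := thetaThree_pos h0 h1
  have h4 := thetaFour_ne_zero h0 h1
  rw [← gaussIntegral_agm (by positivity : 0 < thetaThree q ^ 2)
    (by positivity : 0 < thetaFour q ^ 2)]
  congr 1
  · linear_combination (-1 / 2 : ℝ) * thetaThree_sq h0 h1 - 1 / 2 * thetaFour_sq h0 h1
  · rw [← mul_pow, thetaThree_mul_thetaFour h0 h1, sqrt_sq (sq_nonneg _)]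

lemma tendsto_tsum_mul_pow_two_pow {ε : ℤ → ℝ} (hε : ∀ n, |ε n| = 1) (hε0 : ε 0 = 1) {q : ℝ}
    (h0 : 0 < q) (h1 : q < 1) :
    Tendsto (fun m : ℕ => ∑' n : ℤ, ε n * (q ^ 2 ^ m) ^ (n ^ 2)) atTop (𝓝 1) := by
  have hq : Tendsto (fun m : ℕ => q ^ 2 ^ m) atTop (𝓝 0) :=
    (tendsto_pow_atTop_nhds_zero_of_lt_one h0.le h1).comp
      (tendsto_pow_atTop_atTop_of_one_lt one_lt_two)
  have h := tendsto_tsum_of_dominated_convergence (𝓕 := atTop)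
    (f := fun (m : ℕ) (n : ℤ) => ε n * (q ^ 2 ^ m) ^ (n ^ 2))
    (g := fun n : ℤ => if n = 0 then 1 else 0) (summable_thetaThree h0 h1) ?_ ?_
  · simpa using h
  · intro n
    rcases eq_or_ne n 0 with rfl | hn
    · simp [hε0]
    · simp only [if_neg hn]
      refine squeeze_zero_norm (fun m => ?_) hq
      rw [norm_mul, norm_eq_abs, hε, one_mul, norm_of_nonneg (by positivity)]
      calc (q ^ 2 ^ m) ^ (n ^ 2) ≤ (q ^ 2 ^ m) ^ (1 : ℤ) :=
            zpow_le_zpow_right_of_le_one₀ (by positivity) (pow_le_one₀ h0.le h1.le)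
              (by have : 0 < n ^ 2 := by positivity
                  omega)
        _ = q ^ 2 ^ m := zpow_one _
  · refine Eventually.of_forall fun m n => ?_
    rw [norm_mul, norm_eq_abs, hε, one_mul, norm_of_nonneg (by positivity)]
    refine zpow_le_zpow_left₀ (sq_nonneg n) (by positivity) ?_
    exact pow_le_of_le_one h0.le h1.le (by positivity)

/-- The arithmetic-geometric mean of `θ₃²` and `θ₄²` is `1`. -/
lemma gaussIntegral_theta {q : ℝ} (h0 : 0 < q) (h1 : q < 1) :
    gaussIntegral (thetaThree q ^ 2) (thetaFour q ^ 2) = π / 2 := by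
  have hstep : ∀ m : ℕ, gaussIntegral (thetaThree (q ^ 2 ^ m) ^ 2) (thetaFour (q ^ 2 ^ m) ^ 2) =
      gaussIntegral (thetaThree q ^ 2) (thetaFour q ^ 2) := fun m => by
    induction m with
    | zero => simp
    | succ m ih =>
      rw [pow_succ 2, pow_mul, gaussIntegral_theta_sq (by positivity)
        (pow_lt_one₀ h0.le h1 (by positivity)), ih]
  have t3 := (tendsto_tsum_mul_pow_two_pow (ε := fun _ => 1) (by simp) rfl h0 h1).pow 2
  have t4 := (tendsto_tsum_mul_pow_two_pow (ε := fun n => (-1) ^ n) (by simp [abs_zpow]) (by simp)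
    h0 h1).pow 2
  simp only [one_mul, one_pow] at t3 t4
  have h := tendsto_gaussIntegral t3 t4
  exact tendsto_nhds_unique (tendsto_const_nhds.congr fun m => (hstep m).symm) h

lemma ellK_eq_mul_gaussIntegral {x a b : ℝ} (ha : 0 < a) (hx : x ^ 2 = 1 - b ^ 2 / a ^ 2) :
    ellK x = a * gaussIntegral a b := by
  rw [ellK, gaussIntegral, ← intervalIntegral.integral_const_mul]
  refine intervalIntegral.integral_congr fun θ _ => ?_
  have h : 1 - x ^ 2 * sin θ ^ 2 = (a ^ 2 * cos θ ^ 2 + b ^ 2 * sin θ ^ 2) / a ^ 2 := by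
    rw [hx, cos_sq']
    field_simp
    ring
  simp only [h]
  rw [neg_div, rpow_neg (by positivity), ← sqrt_eq_rpow, sqrt_div' _ (sq_nonneg a),
    sqrt_sq ha.le, inv_div, div_eq_mul_inv]

/-- The elliptic modulus `θ₂² / θ₃²` as a function of the nome. -/
noncomputable def thetaModulus (q : ℝ) : ℝ := √q * thetaTwo q ^ 2 / thetaThree q ^ 2

lemma thetaModulus_pos {q : ℝ} (h0 : 0 < q) (h1 : q < 1) : 0 < thetaModulus q := by
  have h2 := thetaTwo_pos h0 h1
  have h3 := thetaThree_pos h0 h1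
  unfold thetaModulus
  positivity

lemma one_sub_thetaModulus_sq {q : ℝ} (h0 : 0 < q) (h1 : q < 1) :
    1 - thetaModulus q ^ 2 = (thetaFour q ^ 2) ^ 2 / (thetaThree q ^ 2) ^ 2 := by
  have h3 := thetaThree_pos h0 h1
  have hJ := thetaThree_pow_four_sub h0 h1
  rw [thetaModulus, div_pow, mul_pow, sq_sqrt h0.le]
  field_simp
  linear_combination hJ

lemma thetaModulus_lt_one {q : ℝ} (h0 : 0 < q) (h1 : q < 1) : thetaModulus q < 1 := by
  have h3 := thetaThree_pos h0 h1
  have h4 := thetaFour_ne_zero h0 h1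
  have h := one_sub_thetaModulus_sq h0 h1
  have : 0 < (thetaFour q ^ 2) ^ 2 / (thetaThree q ^ 2) ^ 2 := by positivity
  nlinarith [thetaModulus_pos h0 h1]

lemma ellK_thetaModulus {q : ℝ} (h0 : 0 < q) (h1 : q < 1) :
    ellK (thetaModulus q) = π / 2 * thetaThree q ^ 2 := by
  have h3 := thetaThree_pos h0 h1
  rw [ellK_eq_mul_gaussIntegral (a := thetaThree q ^ 2) (b := thetaFour q ^ 2) (by positivity)
    (by linear_combination -one_sub_thetaModulus_sq h0 h1), gaussIntegral_theta h0 h1, mul_comm]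

lemma sqrt_one_sub_thetaModulus_nome_sq {t : ℝ} (ht : 0 < t) :
    √(1 - thetaModulus (nome t) ^ 2) = thetaModulus (nome t⁻¹) := by
  have h3 := thetaThree_pos (nome_pos t) (nome_lt_one ht)
  have hs : √(nome t⁻¹) = nome (t⁻¹ / 2) := by
    rw [sqrt_eq_iff_mul_self_eq (nome_pos _).le (nome_pos _).le, ← sq, nome_sq]
    congr 1; ring
  rw [one_sub_thetaModulus_sq (nome_pos t) (nome_lt_one ht), ← div_pow, sqrt_sq (by positivity),
    thetaModulus, hs, nome_mul_thetaTwo_nome_inv_sq ht, thetaThree_nome_inv_sq ht,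
    mul_div_mul_left _ _ ht.ne']

lemma ellK_sqrt_one_sub_thetaModulus_sq {t : ℝ} (ht : 0 < t) :
    ellK √(1 - thetaModulus (nome t) ^ 2) = t * ellK (thetaModulus (nome t)) := by
  rw [sqrt_one_sub_thetaModulus_nome_sq ht, ellK_thetaModulus (nome_pos _) (nome_lt_one ht),
    ellK_thetaModulus (nome_pos _) (nome_lt_one (inv_pos.2 ht)), thetaThree_nome_inv_sq ht]
  ring

lemma one_sub_sq_mul_sin_sq_pos {x : ℝ} (h0 : 0 ≤ x) (h1 : x < 1) (θ : ℝ) :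
    0 < 1 - x ^ 2 * sin θ ^ 2 := by
  nlinarith [sin_sq_le_one θ, sq_nonneg x,
    mul_nonneg (sq_nonneg x) (sub_nonneg.2 (sin_sq_le_one θ))]

lemma continuous_ellK_integrand {x : ℝ} (h0 : 0 ≤ x) (h1 : x < 1) :
    Continuous fun θ => (1 - x ^ 2 * sin θ ^ 2) ^ (-(1 : ℝ) / 2) :=
  Continuous.rpow_const (by fun_prop) fun θ => .inl (one_sub_sq_mul_sin_sq_pos h0 h1 θ).ne'

lemma ellK_lt_ellK {x y : ℝ} (h0 : 0 ≤ x) (hxy : x < y) (h1 : y < 1) : ellK x < ellK y := by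
  have hle : x ^ 2 ≤ y ^ 2 := by gcongr
  have hlt : x ^ 2 < y ^ 2 := by gcongr
  refine intervalIntegral.integral_lt_integral_of_continuousOn_of_le_of_exists_lt (by positivity)
    (continuous_ellK_integrand h0 (hxy.trans h1)).continuousOn
    (continuous_ellK_integrand (h0.trans hxy.le) h1).continuousOn (fun θ _ => ?_)
    ⟨π / 2, ⟨by positivity, le_rfl⟩, ?_⟩
  · refine rpow_le_rpow_of_nonpos (one_sub_sq_mul_sin_sq_pos (h0.trans hxy.le) h1 θ) ?_
      (by norm_num)
    gcongr
  · refine rpow_lt_rpow_of_neg (one_sub_sq_mul_sin_sq_pos (h0.trans hxy.le) h1 _) ?_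
      (by norm_num)
    simpa using hlt

/-- The ratio of the complementary integral to `ellK k` determines the modulus. -/
lemma modulus_unique {t x y : ℝ} (ht : 0 < t) (hx0 : 0 < x) (hx1 : x < 1) (hy0 : 0 < y)
    (hy1 : y < 1) (hx : ellK √(1 - x ^ 2) = t * ellK x) (hy : ellK √(1 - y ^ 2) = t * ellK y) :
    x = y := by
  wlog hxy : x < y generalizing x y
  · rcases (not_lt.1 hxy).lt_or_eq with h | h
    · exact (this hy0 hy1 hx0 hx1 hy hx h).symm
    · exact h.symm
  have h1 := ellK_lt_ellK hx0.le hxy hy1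
  have h2 : ellK √(1 - y ^ 2) < ellK √(1 - x ^ 2) := by
    refine ellK_lt_ellK (sqrt_nonneg _) (sqrt_lt_sqrt (by nlinarith) (by nlinarith)) ?_
    rw [sqrt_lt' one_pos]
    nlinarith
  nlinarith

/-- The singular modulus in terms of theta functions of the nome. -/
lemma eq_thetaModulus_nome {t k : ℝ} (ht : 0 < t) (hk0 : 0 < k) (hk1 : k < 1)
    (hk : ellK √(1 - k ^ 2) = t * ellK k) : k = thetaModulus (nome t) :=
  modulus_unique ht hk0 hk1 (thetaModulus_pos (nome_pos t) (nome_lt_one ht))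
    (thetaModulus_lt_one (nome_pos t) (nome_lt_one ht)) hk (ellK_sqrt_one_sub_thetaModulus_sq ht)

/-! ### A finite Jacobi triple product and its limit -/

/-- The reciprocal `1 / ((1 - Q) ⋯ (1 - Q^n))` of the `q`-Pochhammer symbol, extended by `0` to
negative integers `n`. -/
noncomputable def invQPochhammer (Q : ℝ) : ℤ → ℝ
  | .ofNat n => (∏ i ∈ Finset.range n, (1 - Q ^ (i + 1)))⁻¹
  | .negSucc _ => 0

lemma invQPochhammer_zero (Q : ℝ) : invQPochhammer Q 0 = 1 := by
  change (∏ i ∈ Finset.range 0, (1 - Q ^ (i + 1)))⁻¹ = 1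
  simp

lemma one_sub_pow_succ_pos {Q : ℝ} (h0 : 0 < Q) (h1 : Q < 1) (i : ℕ) : 0 < 1 - Q ^ (i + 1) :=
  sub_pos.2 (pow_lt_one₀ h0.le h1 i.succ_ne_zero)

lemma invQPochhammer_eq {Q : ℝ} (h0 : 0 < Q) (h1 : Q < 1) (n : ℤ) :
    invQPochhammer Q n = (1 - Q ^ (n + 1)) * invQPochhammer Q (n + 1) := by
  match n with
  | .ofNat n =>
    have h := one_sub_pow_succ_pos h0 h1 n
    have e : (Int.ofNat n + 1 : ℤ) = Int.ofNat (n + 1) := rfl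
    rw [e, invQPochhammer, invQPochhammer, Finset.prod_range_succ, mul_inv_rev,
      Int.ofNat_eq_natCast, zpow_natCast, mul_inv_cancel_left₀ h.ne']
  | .negSucc 0 => simp [invQPochhammer]
  | .negSucc (k + 1) =>
    have e : (Int.negSucc (k + 1) + 1 : ℤ) = Int.negSucc k := rfl
    rw [e, invQPochhammer, invQPochhammer, mul_zero]

lemma invQPochhammer_of_neg (Q : ℝ) {n : ℤ} (hn : n < 0) : invQPochhammer Q n = 0 := by
  match n with
  | .ofNat n => exact absurd hn (by simp)
  | .negSucc k => rfl

lemma invQPochhammer_nonneg {Q : ℝ} (h0 : 0 < Q) (h1 : Q < 1) (n : ℤ) :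
    0 ≤ invQPochhammer Q n := by
  match n with
  | .ofNat n => exact inv_nonneg.2 (Finset.prod_nonneg fun i _ => (one_sub_pow_succ_pos h0 h1 i).le)
  | .negSucc k => exact le_rfl

lemma exists_tendsto_invQPochhammer {Q : ℝ} (h0 : 0 < Q) (h1 : Q < 1) :
    ∃ W, 0 < W ∧ Tendsto (invQPochhammer Q) atTop (𝓝 W) := by
  have hs : Summable fun i : ℕ => -Q ^ (i + 1) :=
    ((summable_nat_add_iff 1).2 (summable_geometric_of_lt_one h0.le h1)).neg
  have hp := hasProd_of_hasSum_log
    (fun i => by simpa [← sub_eq_add_neg] using one_sub_pow_succ_pos h0 h1 i)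
    (summable_log_one_add_of_summable hs).hasSum
  have ht := hp.tendsto_prod_nat.inv₀ (exp_ne_zero _)
  simp only [← sub_eq_add_neg] at ht
  refine ⟨(exp (∑' i : ℕ, log (1 - Q ^ (i + 1))))⁻¹, inv_pos.2 (exp_pos _), ?_⟩
  rw [← Nat.map_cast_int_atTop, tendsto_map'_iff]
  exact ht

lemma exists_invQPochhammer_le {Q : ℝ} (h0 : 0 < Q) (h1 : Q < 1) :
    ∃ C, ∀ n, invQPochhammer Q n ≤ C := by
  obtain ⟨W, -, hW⟩ := exists_tendsto_invQPochhammer h0 h1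
  obtain ⟨C, hC⟩ := (hW.comp tendsto_natCast_atTop_atTop).bddAbove_range
  refine ⟨C, fun n => ?_⟩
  rcases lt_or_ge n 0 with hn | hn
  · rw [invQPochhammer_of_neg Q hn]
    exact (invQPochhammer_nonneg h0 h1 _).trans (hC ⟨0, rfl⟩)
  · lift n to ℕ using hn
    exact hC ⟨n, rfl⟩

/-- The terms of the finite Jacobi triple product, up to normalisation. -/
noncomputable def tripleTerm (q z : ℝ) (N : ℕ) (j : ℤ) : ℝ :=
  invQPochhammer (q ^ 2) (N + j) * invQPochhammer (q ^ 2) (N - j) * (q ^ (j ^ 2) * z ^ j)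

lemma summable_tripleTerm (q z : ℝ) (N : ℕ) : Summable (tripleTerm q z N) := by
  refine summable_of_ne_finset_zero (s := Finset.Icc (-(N : ℤ)) N) fun j hj => ?_
  rw [Finset.mem_Icc, not_and_or, not_le, not_le] at hj
  unfold tripleTerm
  rcases hj with hj | hj
  · rw [invQPochhammer_of_neg _ (by omega : (N : ℤ) + j < 0)]
    simp
  · rw [invQPochhammer_of_neg _ (by omega : (N : ℤ) - j < 0)]
    simp

lemma tripleTerm_succ {q z : ℝ} (h0 : 0 < q) (h1 : q < 1) (hz : 0 < z)
    (N : ℕ) (j : ℤ) :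
    (1 - (q ^ 2) ^ (2 * N + 1)) * (1 - (q ^ 2) ^ (2 * N + 2)) * tripleTerm q z (N + 1) j =
      (1 + q ^ (2 * (2 * N + 1))) * tripleTerm q z N j +
        (z * q ^ (2 * N + 1) * tripleTerm q z N (j - 1) +
        z⁻¹ * q ^ (2 * N + 1) * tripleTerm q z N (j + 1)) := by
  have hQ0 : 0 < q ^ 2 := by positivity
  have hQ1 : q ^ 2 < 1 := by nlinarith
  have w1 := invQPochhammer_eq hQ0 hQ1 (N + j)
  have w2 := invQPochhammer_eq hQ0 hQ1 (N - j)
  have w3 := invQPochhammer_eq hQ0 hQ1 (N + (j - 1))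
  have w4 := invQPochhammer_eq hQ0 hQ1 (N - (j + 1))
  rw [show (N : ℤ) + (j - 1) + 1 = N + j by ring] at w3
  rw [show (N : ℤ) - (j + 1) + 1 = N - j by ring] at w4
  unfold tripleTerm
  rw [w3, w4, w1, w2, show (N : ℤ) + (j + 1) = N + j + 1 by ring,
    show (N : ℤ) - (j - 1) = N - j + 1 by ring, Nat.cast_succ,
    show (N : ℤ) + 1 + j = N + j + 1 by ring, show (N : ℤ) + 1 - j = N - j + 1 by ring]
  generalize invQPochhammer (q ^ 2) (N + j + 1) = u
  generalize invQPochhammer (q ^ 2) (N - j + 1) = v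
  have e1 : q ^ ((j - 1) ^ 2) = q ^ (j ^ 2) * q / (q ^ j) ^ 2 := by
    rw [show (j - 1) ^ 2 = j ^ 2 + 1 - j * 2 by ring, zpow_sub₀ h0.ne', zpow_add_one₀ h0.ne',
      zpow_mul]
    norm_cast
  have e2 : q ^ ((j + 1) ^ 2) = q ^ (j ^ 2) * q * (q ^ j) ^ 2 := by
    rw [show (j + 1) ^ 2 = j ^ 2 + 1 + j * 2 by ring, zpow_add₀ h0.ne', zpow_add_one₀ h0.ne',
      zpow_mul]
    norm_cast
  rw [e1, e2, zpow_add_one₀ hz.ne', zpow_sub_one₀ hz.ne']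
  have e3 : ∀ i : ℤ, (q ^ 2) ^ i = (q ^ i) ^ 2 := fun i => by
    rw [← zpow_natCast, ← zpow_natCast, ← zpow_mul, ← zpow_mul, mul_comm]
  simp only [e3, zpow_add₀ h0.ne', zpow_sub₀ h0.ne', zpow_one, zpow_natCast]
  have hy : q ^ j ≠ 0 := (zpow_pos h0 _).ne'
  generalize q ^ j = y at *
  have e4 : (q ^ 2) ^ (2 * N + 1) = (q ^ N) ^ 4 * q ^ 2 := by ring
  have e5 : (q ^ 2) ^ (2 * N + 2) = (q ^ N) ^ 4 * q ^ 4 := by ring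
  have e6 : q ^ (2 * (2 * N + 1)) = (q ^ N) ^ 4 * q ^ 2 := by ring
  have e7 : q ^ (2 * N + 1) = (q ^ N) ^ 2 * q := by ring
  rw [e4, e5, e6, e7]
  generalize q ^ N = x
  generalize q ^ (j ^ 2) = g
  generalize z ^ j = t
  field_simp
  ring

lemma tsum_tripleTerm_succ {q z : ℝ} (h0 : 0 < q) (h1 : q < 1) (hz : 0 < z)
    (N : ℕ) :
    (1 - (q ^ 2) ^ (2 * N + 1)) * (1 - (q ^ 2) ^ (2 * N + 2)) * ∑' j, tripleTerm q z (N + 1) j =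
      (1 + z * q ^ (2 * N + 1)) * (1 + z⁻¹ * q ^ (2 * N + 1)) * ∑' j, tripleTerm q z N j := by
  have s := summable_tripleTerm q z N
  have s1 : Summable fun j => tripleTerm q z N (j - 1) :=
    s.comp_injective (sub_left_injective (b := (1 : ℤ)))
  have s2 : Summable fun j => tripleTerm q z N (j + 1) :=
    s.comp_injective (add_left_injective (1 : ℤ))
  have t1 : ∑' j, tripleTerm q z N (j - 1) = ∑' j, tripleTerm q z N j :=
    (Equiv.subRight (1 : ℤ)).tsum_eq (tripleTerm q z N)
  have t2 : ∑' j, tripleTerm q z N (j + 1) = ∑' j, tripleTerm q z N j :=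
    (Equiv.addRight (1 : ℤ)).tsum_eq (tripleTerm q z N)
  rw [← tsum_mul_left, tsum_congr (tripleTerm_succ h0 h1 hz N),
    (s.mul_left _).tsum_add ((s1.mul_left _).add (s2.mul_left _)),
    (s1.mul_left _).tsum_add (s2.mul_left _), tsum_mul_left, tsum_mul_left, tsum_mul_left, t1, t2]
  field_simp
  ring

/-- The finite Jacobi triple product. -/
lemma prod_mul_tsum_tripleTerm {q z : ℝ} (h0 : 0 < q) (h1 : q < 1) (hz : 0 < z)
    (N : ℕ) :
    (∏ i ∈ Finset.range (2 * N), (1 - (q ^ 2) ^ (i + 1))) * ∑' j, tripleTerm q z N j =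
      ∏ i ∈ Finset.range N, ((1 + z * q ^ (2 * i + 1)) * (1 + z⁻¹ * q ^ (2 * i + 1))) := by
  induction N with
  | zero =>
    rw [tsum_eq_single 0]
    · simp [tripleTerm, invQPochhammer_zero]
    · intro j hj
      unfold tripleTerm
      rcases lt_or_gt_of_ne hj with h | h
      · rw [invQPochhammer_of_neg _ (by simpa using h)]
        simp
      · rw [invQPochhammer_of_neg _ (n := ((0 : ℕ) : ℤ) - j) (by simpa using h)]
        simp
  | succ N ih =>
    rw [Finset.prod_range_succ, ← ih, show 2 * (N + 1) = 2 * N + 1 + 1 by ring,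
      Finset.prod_range_succ, Finset.prod_range_succ]
    linear_combination (∏ i ∈ Finset.range (2 * N), (1 - (q ^ 2) ^ (i + 1))) *
      tsum_tripleTerm_succ h0 h1 hz N

lemma tendsto_tsum_tripleTerm {q z : ℝ} (h0 : 0 < q) (h1 : q < 1) (hz : 0 < z)
    {W : ℝ} (hW : Tendsto (invQPochhammer (q ^ 2)) atTop (𝓝 W))
    (hs : Summable fun j : ℤ => q ^ (j ^ 2) * z ^ j) :
    Tendsto (fun N => ∑' j, tripleTerm q z N j) atTop
      (𝓝 (W * W * ∑' j : ℤ, q ^ (j ^ 2) * z ^ j)) := by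
  have hQ0 : 0 < q ^ 2 := by positivity
  have hQ1 : q ^ 2 < 1 := by nlinarith
  obtain ⟨C, hC⟩ := exists_invQPochhammer_le hQ0 hQ1
  have hw := invQPochhammer_nonneg hQ0 hQ1
  have hcast : Tendsto (fun N : ℕ => (N : ℤ)) atTop atTop := tendsto_natCast_atTop_atTop
  rw [← tsum_mul_left]
  refine tendsto_tsum_of_dominated_convergence (hs.mul_left (C * C)) (fun j => ?_)
    (Eventually.of_forall fun N j => ?_)
  · refine Tendsto.mul_const _ (.mul ?_ ?_)
    · exact hW.comp (tendsto_atTop_add_const_right _ _ hcast)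
    · exact hW.comp (tendsto_atTop_add_const_right _ (-j) hcast)
  · have hnn : 0 ≤ q ^ (j ^ 2) * z ^ j := by positivity
    unfold tripleTerm
    rw [norm_of_nonneg (mul_nonneg (mul_nonneg (hw _) (hw _)) hnn)]
    have hC0 := (hw 0).trans (hC 0)
    gcongr
    · exact hw _
    · exact hC _
    · exact hC _

lemma tendsto_prod_div_prod {q : ℝ} (h0 : 0 < q) (h1 : q < 1) :
    Tendsto (fun N : ℕ =>
      (∏ i ∈ Finset.range N, ((1 + q * q ^ (2 * i + 1)) * (1 + q⁻¹ * q ^ (2 * i + 1)))) /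
        ∏ i ∈ Finset.range N, ((1 + 1 * q ^ (2 * i + 1)) * (1 + 1⁻¹ * q ^ (2 * i + 1))))
      atTop (𝓝 (thetaTwo q / thetaThree q)) := by
  have hQ0 : 0 < q ^ 2 := by positivity
  have hQ1 : q ^ 2 < 1 := by nlinarith
  obtain ⟨W, hW0, hW⟩ := exists_tendsto_invQPochhammer hQ0 hQ1
  have e2 : ∀ j : ℤ, q ^ (j ^ 2) * q ^ j = q ^ (j ^ 2 + j) := fun j => (zpow_add₀ h0.ne' _ _).symm
  have t2 := tendsto_tsum_tripleTerm h0 h1 h0 hW (by simpa only [e2] using summable_thetaTwo h0 h1)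
  have t3 := tendsto_tsum_tripleTerm h0 h1 one_pos hW
    (by simpa only [one_zpow, mul_one] using summable_thetaThree h0 h1)
  simp only [e2] at t2
  simp only [one_zpow, mul_one] at t3
  have hne : W * W * thetaThree q ≠ 0 :=
    (mul_pos (mul_pos hW0 hW0) (thetaThree_pos h0 h1)).ne'
  have h := t2.div t3 hne
  rw [mul_div_mul_left _ _ (mul_pos hW0 hW0).ne'] at h
  refine h.congr fun N => ?_
  rw [← prod_mul_tsum_tripleTerm h0 h1 h0, ← prod_mul_tsum_tripleTerm h0 h1 one_pos,
    mul_div_mul_left]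
  · rfl
  · exact (Finset.prod_pos fun i _ => one_sub_pow_succ_pos hQ0 hQ1 i).ne'

/-! ### The logarithm of `thetaTwo q / thetaThree q` -/

/-- The terms of the alternating series for `log (thetaTwo q / (2 * thetaThree q)) / 2`. -/
noncomputable def altLog (q : ℝ) (m : ℕ) : ℝ := (-1) ^ (m + 1) * log (1 + q ^ (m + 1))

lemma summable_altLog {q : ℝ} (h0 : 0 < q) (h1 : q < 1) : Summable (altLog q) := by
  have hs : Summable fun m : ℕ => q ^ (m + 1) :=
    (summable_nat_add_iff 1).2 (summable_geometric_of_lt_one h0.le h1)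
  refine Summable.of_norm ?_
  simpa [altLog, abs_mul] using (summable_log_one_add_of_summable hs).norm

lemma prod_eq_exp_sum_altLog {q : ℝ} (h0 : 0 < q) (N : ℕ) :
    (∏ i ∈ Finset.range N, ((1 + q * q ^ (2 * i + 1)) * (1 + q⁻¹ * q ^ (2 * i + 1)))) *
        (1 + q ^ (2 * N)) =
      2 * exp (2 * ∑ m ∈ Finset.range (2 * N), altLog q m) *
        ∏ i ∈ Finset.range N, ((1 + 1 * q ^ (2 * i + 1)) * (1 + 1⁻¹ * q ^ (2 * i + 1))) := by
  induction N with
  | zero => norm_num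
  | succ N ih =>
    have hp : ∀ m : ℕ, 0 < 1 + q ^ m := fun m => by positivity
    have e1 : exp (2 * altLog q (2 * N)) = ((1 + q ^ (2 * N + 1)) ^ 2)⁻¹ := by
      rw [altLog, Odd.neg_one_pow ⟨N, rfl⟩, neg_one_mul, mul_neg, exp_neg, two_mul, exp_add,
        exp_log (hp _), sq]
    have e2 : exp (2 * altLog q (2 * N + 1)) = (1 + q ^ (2 * N + 2)) ^ 2 := by
      rw [altLog, Even.neg_one_pow ⟨N + 1, by ring⟩, one_mul, two_mul, exp_add,
        exp_log (hp _), sq]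
    have e3 : q⁻¹ * q ^ (2 * N + 1) = q ^ (2 * N) := by
      rw [pow_succ']
      exact inv_mul_cancel_left₀ h0.ne' _
    have e4 : q * q ^ (2 * N + 1) = q ^ (2 * N + 2) := (pow_succ' _ _).symm
    rw [Finset.prod_range_succ, Finset.prod_range_succ, show 2 * (N + 1) = 2 * N + 1 + 1 by ring,
      Finset.sum_range_succ, Finset.sum_range_succ, mul_add 2 (_ + _), mul_add 2, exp_add,
      exp_add, e1, e2, e3, e4]
    have h := (hp (2 * N + 1)).ne'
    generalize ∏ i ∈ Finset.range N, ((1 + q * q ^ (2 * i + 1)) * (1 + q⁻¹ * q ^ (2 * i + 1))) = A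
      at *
    generalize ∏ i ∈ Finset.range N, ((1 + 1 * q ^ (2 * i + 1)) * (1 + 1⁻¹ * q ^ (2 * i + 1))) = B
      at *
    rw [inv_one, one_mul]
    field_simp
    linear_combination ih

lemma thetaTwo_div_thetaThree {q : ℝ} (h0 : 0 < q) (h1 : q < 1) :
    thetaTwo q / thetaThree q = 2 * exp (2 * ∑' m, altLog q m) := by
  refine tendsto_nhds_unique (tendsto_prod_div_prod h0 h1) ?_
  have h2 : Tendsto (fun N : ℕ => 2 * N) atTop atTop :=
    tendsto_id.const_mul_atTop' two_pos
  have ha := (summable_altLog h0 h1).hasSum.tendsto_sum_nat.comp h2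
  have hq := (tendsto_pow_atTop_nhds_zero_of_lt_one h0.le h1).comp h2
  have h := (((continuous_exp.tendsto _).comp (ha.const_mul 2)).const_mul 2).div
    (hq.const_add 1) (by norm_num)
  rw [add_zero, div_one] at h
  refine h.congr fun N => ?_
  have hN : 0 < 1 + q ^ (2 * N) := by positivity
  have hd : 0 < ∏ i ∈ Finset.range N, ((1 + 1 * q ^ (2 * i + 1)) * (1 + 1⁻¹ * q ^ (2 * i + 1))) :=
    Finset.prod_pos fun i _ => by positivity
  rw [eq_div_iff hd.ne']
  simp only [Pi.div_apply, Function.comp_apply]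
  rw [div_mul_eq_mul_div, div_eq_iff hN.ne', prod_eq_exp_sum_altLog h0]

lemma summable_lambertTerm {q : ℝ} (h0 : 0 < q) (h1 : q < 1) :
    Summable fun c : ℕ+ × ℕ+ =>
      (-1 : ℝ) ^ ((c.1 : ℕ) + c.2) * q ^ ((c.1 : ℕ) * c.2) / ((c.2 : ℕ) : ℝ) := by
  have hs := summable_prod_mul_pow 0 (r := q) (by rwa [norm_of_nonneg h0.le])
  refine Summable.of_norm_bounded hs fun c => ?_
  have hc : (1 : ℝ) ≤ ((c.2 : ℕ) : ℝ) := Nat.one_le_cast.2 c.2.pos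
  rw [norm_div, norm_mul, norm_pow, norm_neg, norm_one, one_pow, one_mul, pow_zero, one_mul,
    norm_of_nonneg (by positivity), norm_of_nonneg (by positivity)]
  exact div_le_self (by positivity) hc

lemma altLog_eq_tsum {q : ℝ} (h0 : 0 < q) (h1 : q < 1) (m : ℕ) :
    altLog q m = -∑' b : ℕ+,
      (-1 : ℝ) ^ (m + 1 + (b : ℕ)) * q ^ ((m + 1) * (b : ℕ)) / ((b : ℕ) : ℝ) := by
  have hq : |-q ^ (m + 1)| < 1 := by
    rw [abs_neg, abs_of_pos (by positivity)]
    exact pow_lt_one₀ h0.le h1 m.succ_ne_zero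
  have h := (hasSum_pow_div_log_of_abs_lt_one hq).tsum_eq
  rw [sub_neg_eq_add] at h
  rw [altLog, ← neg_eq_iff_eq_neg.2 h.symm.symm, mul_neg, neg_inj, ← tsum_mul_left,
    tsum_pnat_eq_tsum_succ
      (f := fun b : ℕ => (-1 : ℝ) ^ (m + 1 + b) * q ^ ((m + 1) * b) / (b : ℝ))]
  refine tsum_congr fun b => ?_
  rw [neg_pow (q ^ (m + 1)), ← pow_mul, pow_add _ (m + 1)]
  push_cast
  ring

lemma tsum_altLog {q : ℝ} (h0 : 0 < q) (h1 : q < 1) :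
    ∑' m, altLog q m = -∑' n : ℕ, q ^ ((n : ℝ) + 1) *
      ∑ d ∈ (n + 1).divisors, (-1 : ℝ) ^ (d + (n + 1) / d) / (d : ℝ) := by
  have hs := summable_lambertTerm h0 h1
  rw [tsum_congr (altLog_eq_tsum h0 h1), tsum_neg, neg_inj,
    ← tsum_pnat_eq_tsum_succ (f := fun a : ℕ => ∑' b : ℕ+,
      (-1 : ℝ) ^ (a + (b : ℕ)) * q ^ (a * (b : ℕ)) / ((b : ℕ) : ℝ)),
    ← hs.tsum_prod, ← sigmaAntidiagonalEquivProd.tsum_eq]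
  refine (Summable.tsum_sigma (sigmaAntidiagonalEquivProd.summable_iff.2 hs)).trans ?_
  have e : ∀ n : ℕ, q ^ ((n : ℝ) + 1) = q ^ (n + 1) := fun n => by
    rw [← rpow_natCast, Nat.cast_succ]
  simp only [e]
  rw [← tsum_pnat_eq_tsum_succ (f := fun n : ℕ => q ^ n *
    ∑ d ∈ n.divisors, (-1 : ℝ) ^ (d + n / d) / (d : ℝ))]
  refine tsum_congr fun n => ?_
  rw [tsum_fintype, Finset.univ_eq_attach]
  refine ((n : ℕ).divisorsAntidiagonal.sum_attach fun x : ℕ × ℕ =>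
    (-1 : ℝ) ^ (x.1 + x.2) * q ^ (x.1 * x.2) / (x.2 : ℝ)).trans ?_
  rw [Nat.sum_divisorsAntidiagonal' fun x y => (-1 : ℝ) ^ (x + y) * q ^ (x * y) / (y : ℝ),
    Finset.mul_sum]
  refine Finset.sum_congr rfl fun d hd => ?_
  rw [Nat.div_mul_cancel (Nat.dvd_of_mem_divisors hd), add_comm d]
  ring

theorem stmt11 (r : ℝ) (hr : 0 < r) (q : ℝ) (hq : q = Real.exp (-π * Real.sqrt r))
    (k : ℝ) (hk0 : 0 < k) (hk1 : k < 1)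
    (hk : ellK (Real.sqrt (1 - k ^ 2)) = Real.sqrt r * ellK k) :
    k = 4 * q ^ ((1 : ℝ) / 2) *
      Real.exp (-4 * ∑' n : ℕ, q ^ ((n : ℝ) + 1) *
        ∑ d ∈ (n + 1).divisors, (-1 : ℝ) ^ (d + (n + 1) / d) / (d : ℝ)) := by
  have ht := sqrt_pos.2 hr
  have hqn : nome √r = q := hq.symm
  have h0 : 0 < q := hqn ▸ nome_pos _
  have h1 : q < 1 := hqn ▸ nome_lt_one ht
  have h := eq_thetaModulus_nome ht hk0 hk1 hk
  rw [hqn, thetaModulus, mul_div_assoc, ← div_pow, thetaTwo_div_thetaThree h0 h1,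
    tsum_altLog h0 h1, sqrt_eq_rpow, mul_pow, ← exp_nat_mul] at h
  rw [h]
  push_cast
  ring_nf
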